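/- For every complex number s with 1 < Re s < 3/2, (1/Γ(s))·∫_0^∞ t^{s−1}·( 1/(2·π^{3/2}·t^{3/2}) )·( ∫_0^∞ x·e^{−x²/t}/sinh(x) dx ) dt = Γ(3/2−s)·Γ(2s−1)·(1 − 2^{1−2s})·ζ(2s−1) / (π^{3/2}·Γ(s)). -/

import Mathlib

open Real Complex MeasureTheory

lemma aux_odd_sum {z : ℂ} (hz : 1 < z.re) :
    HasSum (fun n : ℕ => 1 / ((2 * n + 1 : ℕ) : ℂ) ^ z) ((1 - (2 : ℂ) ^ (-z)) * riemannZeta z) := by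
  have hS : Summable (fun n : ℕ => 1 / (n : ℂ) ^ z) := Complex.summable_one_div_nat_cpow.mpr hz
  have ho : Summable (fun n : ℕ => 1 / ((2 * n + 1 : ℕ) : ℂ) ^ z) :=
    hS.comp_injective (i := fun n : ℕ => 2 * n + 1) (fun a b h => by simpa using h)
  have he0 : ∀ n : ℕ, 1 / ((2 * n : ℕ) : ℂ) ^ z = (2 : ℂ) ^ (-z) * (1 / (n : ℂ) ^ z) := by
    intro n
    rw [Nat.cast_mul, Complex.natCast_mul_natCast_cpow, Complex.cpow_neg]
    push_cast
    rw [one_div, one_div, mul_inv]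
  have hE : HasSum (fun n : ℕ => 1 / ((2 * n : ℕ) : ℂ) ^ z) ((2 : ℂ) ^ (-z) * riemannZeta z) := by
    simp_rw [he0]
    rw [zeta_eq_tsum_one_div_nat_cpow hz]
    exact hS.hasSum.mul_left _
  have h := (HasSum.even_add_odd (f := fun n : ℕ => 1 / (n : ℂ) ^ z) hE ho.hasSum).tsum_eq
  rw [← zeta_eq_tsum_one_div_nat_cpow hz] at h
  have h2 : (1 - (2 : ℂ) ^ (-z)) * riemannZeta z = ∑' n : ℕ, 1 / ((2 * n + 1 : ℕ) : ℂ) ^ z := by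
    linear_combination h
  rw [h2]
  exact ho.hasSum

lemma aux_sinh_sum {x : ℝ} (hx : 0 < x) :
    HasSum (fun n : ℕ => (2 : ℂ) * (Real.exp (-((2 * n + 1 : ℕ) : ℝ) * x) : ℂ))
      (((1 / Real.sinh x : ℝ)) : ℂ) := by
  have h1 : Real.exp (-2 * x) < 1 := by rw [Real.exp_lt_one_iff]; linarith
  have h := (hasSum_geometric_of_lt_one (Real.exp_pos _).le h1).mul_left (2 * Real.exp (-x))
  have h3 : 2 * Real.exp (-x) * (1 - Real.exp (-2 * x))⁻¹ = 1 / Real.sinh x := by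
    have hs := Real.sinh_pos_iff.mpr hx
    have : 1 - Real.exp (-2 * x) = 2 * Real.exp (-x) * Real.sinh x := by
      rw [Real.sinh_eq]
      have e1 : Real.exp (-x) * Real.exp x = 1 := by rw [← Real.exp_add]; simp
      have e2 : Real.exp (-2 * x) = Real.exp (-x) * Real.exp (-x) := by
        rw [← Real.exp_add]; ring_nf
      rw [e2]; linear_combination -e1
    rw [this]
    have := Real.exp_pos (-x)
    field_simp
  rw [h3] at h
  have h4 := Complex.hasSum_ofReal.mpr h
  refine h4.congr_fun ?_
  intro n
  rw [← Real.exp_nat_mul, mul_assoc, ← Real.exp_add]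
  push_cast
  congr 2
  ring

lemma aux_mellin_sinh {z : ℂ} (hz : 1 < z.re) :
    mellin (fun x : ℝ => ((1 / Real.sinh x : ℝ) : ℂ)) z =
      2 * Complex.Gamma z * ((1 - (2 : ℂ) ^ (-z)) * riemannZeta z) := by
  have h := hasSum_mellin (a := fun _ : ℕ => (2 : ℂ)) (p := fun n : ℕ => ((2 * n + 1 : ℕ) : ℝ))
    (F := fun x : ℝ => ((1 / Real.sinh x : ℝ) : ℂ)) (s := z)
    (fun i => Or.inr (by positivity)) (by linarith) (fun t ht => aux_sinh_sum ht) (by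
      have hS : Summable (fun n : ℕ => 1 / (n : ℝ) ^ z.re) :=
        Real.summable_one_div_nat_rpow.mpr hz
      have ho : Summable (fun n : ℕ => 1 / ((2 * n + 1 : ℕ) : ℝ) ^ z.re) :=
        hS.comp_injective (i := fun n : ℕ => 2 * n + 1) (fun a b h => by simpa using h)
      refine (ho.mul_left 2).congr ?_
      intro n
      simp [div_eq_mul_inv])
  refine h.unique ?_
  refine ((aux_odd_sum hz).mul_left (2 * Complex.Gamma z)).congr_fun ?_
  intro n
  push_cast
  ring

lemma aux_mellin_ne {z : ℂ} (hz : 1 < z.re) :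
    2 * Complex.Gamma z * ((1 - (2 : ℂ) ^ (-z)) * riemannZeta z) ≠ 0 := by
  have h1 := Complex.Gamma_ne_zero_of_re_pos (show 0 < z.re by linarith)
  have h2 := riemannZeta_ne_zero_of_one_lt_re hz
  have h3 : (1 - (2 : ℂ) ^ (-z)) ≠ 0 := by
    intro h
    have h4 : ‖(2 : ℂ) ^ (-z)‖ = 1 := by rw [← sub_eq_zero.mp h]; simp
    have h5 := Complex.norm_cpow_eq_rpow_re_of_pos (show (0:ℝ) < 2 by norm_num) (-z)
    push_cast at h5
    rw [h5] at h4
    have := Real.rpow_lt_one_of_one_lt_of_neg (show (1:ℝ) < 2 by norm_num)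
      (show (-z).re < 0 by simp; linarith)
    linarith
  simp [h1, h2, h3]

lemma aux_inner {w : ℂ} (hw : 0 < w.re) {x : ℝ} (hx : 0 < x) :
    ∫ t in Set.Ioi (0 : ℝ), (t : ℂ) ^ (-w - 1) * (Real.exp (-(x ^ 2) / t) : ℂ) =
      (x : ℂ) ^ (-2 * w) * Complex.Gamma w := by
  have h := mellin_comp_inv (fun u : ℝ => Complex.exp (-((x ^ 2 : ℝ) * u : ℂ))) (-w)
  rw [neg_neg] at h
  have h2 := Complex.integral_cpow_mul_exp_neg_mul_Ioi hw (show 0 < x ^ 2 by positivity)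
  simp only [mellin, smul_eq_mul] at h
  rw [h2] at h
  have h3 : (1 / ((x ^ 2 : ℝ) : ℂ)) ^ w = (x : ℂ) ^ (-2 * w) := by
    have hx' : (x : ℂ) ≠ 0 := by exact_mod_cast hx.ne'
    have e : (1 / ((x ^ 2 : ℝ) : ℂ)) = ((x ^ (-2 : ℝ) : ℝ) : ℂ) := by
      rw [Real.rpow_neg hx.le]; push_cast; norm_num
    rw [e, ← Complex.cpow_mul_ofReal_nonneg hx.le]
    push_cast; rfl
  rw [← h3, ← h]
  refine setIntegral_congr_fun measurableSet_Ioi fun t ht => ?_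
  congr 1
  push_cast
  congr 1
  ring

lemma aux_inner_int {w : ℂ} (hw : 0 < w.re) {x : ℝ} (hx : 0 < x) :
    IntegrableOn (fun t : ℝ => (t : ℂ) ^ (-w - 1) * (Real.exp (-(x ^ 2) / t) : ℂ))
      (Set.Ioi 0) := by
  apply Integrable.of_integral_ne_zero
  rw [aux_inner hw hx]
  have hx' : (x : ℂ) ≠ 0 := by exact_mod_cast hx.ne'
  exact mul_ne_zero (by simp [Complex.cpow_eq_zero_iff, hx']) (Complex.Gamma_ne_zero_of_re_pos hw)

lemma aux_inner_norm {w : ℂ} (hw : 0 < w.re) {x : ℝ} (hx : 0 < x) :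
    ∫ t in Set.Ioi (0 : ℝ), ‖(t : ℂ) ^ (-w - 1) * (Real.exp (-(x ^ 2) / t) : ℂ)‖ =
      ‖(x : ℂ) ^ (-2 * w)‖ * Real.Gamma w.re := by
  have h := aux_inner (w := (w.re : ℂ)) (by simpa using hw) hx
  rw [← Complex.ofReal_inj, ← integral_complex_ofReal]
  rw [Complex.norm_cpow_eq_rpow_re_of_pos hx]
  rw [Complex.Gamma_ofReal] at h
  rw [Complex.ofReal_mul, Complex.ofReal_cpow hx.le]
  have e : (((-2 * w).re : ℝ) : ℂ) = -2 * (w.re : ℂ) := by simp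
  rw [e, ← h]
  refine setIntegral_congr_fun measurableSet_Ioi fun t ht => ?_
  have ht' : (0 : ℝ) < t := ht
  rw [norm_mul, Complex.norm_cpow_eq_rpow_re_of_pos ht', Complex.norm_real, Real.norm_eq_abs,
    Real.abs_exp, Complex.ofReal_mul, Complex.ofReal_cpow ht'.le]
  simp

lemma aux_main (s : ℂ) (hs1 : 1 < s.re) (hs2 : s.re < 3 / 2) :
    ∫ t in Set.Ioi (0 : ℝ), ∫ x in Set.Ioi (0 : ℝ),
      ((t : ℂ) ^ (-(3 / 2 - s) - 1) * (Real.exp (-(x ^ 2) / t) : ℂ)) * ((x / Real.sinh x : ℝ) : ℂ)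
    = Complex.Gamma (3 / 2 - s) * (2 * Complex.Gamma (2 * s - 1) *
       ((1 - (2 : ℂ) ^ (-(2 * s - 1))) * riemannZeta (2 * s - 1))) := by
  have hw : 0 < (3 / 2 - s).re := by
    have : (3 / 2 - s).re = 3 / 2 - s.re := by
      simp
    rw [this]; linarith
  have hz : 1 < (2 * s - 1).re := by
    have : (2 * s - 1).re = 2 * s.re - 1 := by simp
    rw [this]; linarith
  have hker : ∀ x ∈ Set.Ioi (0 : ℝ), (x : ℂ) ^ (-2 * (3 / 2 - s)) * ((x / Real.sinh x : ℝ) : ℂ)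
      = (x : ℂ) ^ (2 * s - 1 - 1) • ((1 / Real.sinh x : ℝ) : ℂ) := by
    intro x hx
    have hx' : (x : ℂ) ≠ 0 := by exact_mod_cast (ne_of_gt hx)
    have e : (2 * s - 1 - 1) = -2 * (3 / 2 - s) + 1 := by ring
    rw [e, Complex.cpow_add _ _ hx', Complex.cpow_one, smul_eq_mul]
    push_cast
    ring
  have hM := aux_mellin_sinh hz
  have hMi : IntegrableOn (fun x : ℝ => (x : ℂ) ^ (2 * s - 1 - 1) • ((1 / Real.sinh x : ℝ) : ℂ))
      (Set.Ioi 0) := by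
    apply Integrable.of_integral_ne_zero
    have h := aux_mellin_ne hz
    rw [← hM] at h
    exact h
  have hint : Integrable (Function.uncurry fun (t x : ℝ) =>
      ((t : ℂ) ^ (-(3 / 2 - s) - 1) * (Real.exp (-(x ^ 2) / t) : ℂ)) * ((x / Real.sinh x : ℝ) : ℂ))
      ((volume.restrict (Set.Ioi 0)).prod (volume.restrict (Set.Ioi 0))) := by
    rw [integrable_prod_iff']
    · constructor
      · filter_upwards [ae_restrict_mem measurableSet_Ioi] with x hx
        exact (aux_inner_int hw hx).mul_const ((x / Real.sinh x : ℝ) : ℂ)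
      · have := (hMi.norm).const_mul (Real.Gamma (3 / 2 - s).re)
        refine this.congr ?_
        filter_upwards [ae_restrict_mem measurableSet_Ioi] with x hx
        rw [← hker x hx]
        simp only [Function.uncurry]
        simp_rw [norm_mul _ ((x / Real.sinh x : ℝ) : ℂ)]
        rw [integral_mul_const, aux_inner_norm hw hx]
        ring
    · apply Measurable.aestronglyMeasurable
      unfold Function.uncurry
      fun_prop
  rw [integral_integral_swap hint]
  rw [← hM, mellin, ← integral_const_mul]
  refine setIntegral_congr_fun measurableSet_Ioi fun x hx => ?_
  rw [integral_mul_const, aux_inner hw hx, ← hker x hx]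
  ring

theorem identity_contribution_zeta (s : ℂ) (hs1 : 1 < s.re) (hs2 : s.re < 3 / 2) :
    (1 / Complex.Gamma s) *
        ∫ t in Set.Ioi (0 : ℝ), (t : ℂ) ^ (s - 1) *
          ((1 / (2 * Real.pi ^ ((3 : ℝ) / 2) * t ^ ((3 : ℝ) / 2)) : ℝ) : ℂ) *
          ((∫ x in Set.Ioi (0 : ℝ),
              x * Real.exp (-(x ^ 2) / t) / Real.sinh x : ℝ) : ℂ) =
      Complex.Gamma (3 / 2 - s) * Complex.Gamma (2 * s - 1) *
          (1 - (2 : ℂ) ^ (1 - 2 * s)) * riemannZeta (2 * s - 1) /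
        (((Real.pi ^ ((3 : ℝ) / 2) : ℝ) : ℂ) * Complex.Gamma s) := by
  have h := aux_main s hs1 hs2
  have hpi : ((Real.pi ^ ((3 : ℝ) / 2) : ℝ) : ℂ) ≠ 0 := by
    have : 0 < Real.pi ^ ((3 : ℝ) / 2) := by positivity
    exact_mod_cast this.ne'
  have hG := Complex.Gamma_ne_zero_of_re_pos (show 0 < s.re by linarith)
  have key : ∫ t in Set.Ioi (0 : ℝ), (t : ℂ) ^ (s - 1) *
          ((1 / (2 * Real.pi ^ ((3 : ℝ) / 2) * t ^ ((3 : ℝ) / 2)) : ℝ) : ℂ) *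
          ((∫ x in Set.Ioi (0 : ℝ),
              x * Real.exp (-(x ^ 2) / t) / Real.sinh x : ℝ) : ℂ) =
      (1 / (2 * ((Real.pi ^ ((3 : ℝ) / 2) : ℝ) : ℂ))) *
      ∫ t in Set.Ioi (0 : ℝ), ∫ x in Set.Ioi (0 : ℝ),
      ((t : ℂ) ^ (-(3 / 2 - s) - 1) * (Real.exp (-(x ^ 2) / t) : ℂ)) *
        ((x / Real.sinh x : ℝ) : ℂ) := by
    rw [← integral_const_mul]
    refine setIntegral_congr_fun measurableSet_Ioi fun t ht => ?_
    have ht' : (0 : ℝ) < t := ht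
    have htc : (t : ℂ) ≠ 0 := by exact_mod_cast ht'.ne'
    rw [← integral_complex_ofReal, ← integral_const_mul, ← integral_const_mul]
    refine setIntegral_congr_fun measurableSet_Ioi fun x hx => ?_
    have e : (-(3 / 2 - s) - 1) = (s - 1) - ((3 / 2 : ℝ) : ℂ) := by push_cast; ring
    rw [e, Complex.cpow_sub (s - 1) _ htc, ← Complex.ofReal_cpow ht'.le]
    push_cast
    ring
  rw [key, h]
  have e2 : -(2 * s - 1) = 1 - 2 * s := by ring
  rw [e2]
  field_simp
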